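/- Let u = (u_1,…,u_N) : ℝ^d × [0,T) → ℝ^N be a classical solution of the Allen–Cahn system (AC) with Σ_{i=1}^N u_i(x,t)² = 1 for all (x,t). Fix y ∈ ℝ^d and s > 0, and let ρ(x,t) = ρ_{y,s}(x,t) = (4π(s−t))^{−(d−1)/2} exp(−|x−y|²/(4(s−t))) for t < s. Then for every t ∈ (0, min(T,s)), (d/dt) ∫_{ℝ^d} ρ(x,t) e^ε(x,t) dx ≤ (1/(2(s−t))) ∫_{ℝ^d} ρ(x,t) ζ^ε(x,t) dx, where e^ε = σ⁻¹ Σ_{i=1}^N (ε|∇u_i|²/2 + W(u_i)/ε) and ζ^ε = σ⁻¹ Σ_{i=1}^N (ε|∇u_i|²/2 − W(u_i)/ε), with u extended ℤ^d-periodically to all of ℝ^d. -/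

import Mathlib

open MeasureTheory Set Filter
open scoped InnerProductSpace

noncomputable section

/-- Euclidean space `ℝ^d`. -/
abbrev Euc (d : ℕ) := EuclideanSpace ℝ (Fin d)

/-- The double-well potential `W(s) = s²(1-s)²/2`. -/
def W (s : ℝ) : ℝ := s ^ 2 * (1 - s) ^ 2 / 2

/-- Its derivative `W'(s) = 2s³ - 3s² + s`. -/
def W' (s : ℝ) : ℝ := 2 * s ^ 3 - 3 * s ^ 2 + s

/-- Partial derivative in the `k`-th coordinate direction. -/
def pd (d : ℕ) (k : Fin d) (f : Euc d → ℝ) (x : Euc d) : ℝ :=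
  fderiv ℝ f x (EuclideanSpace.single k 1)

/-- The Laplacian of `f : ℝ^d → ℝ`. -/
def lap (d : ℕ) (f : Euc d → ℝ) (x : Euc d) : ℝ :=
  ∑ k : Fin d, pd d k (fun y => pd d k f y) x

/-- The vector in `ℝ^d` with integer coordinates `v`. -/
def intVec {d : ℕ} (v : Fin d → ℤ) : Euc d :=
  (EuclideanSpace.equiv (Fin d) ℝ).symm (fun k => (v k : ℝ))

/-- A function on `ℝ^d` is `ℤ^d`-periodic if it is invariant under translation by
every integer vector. -/
def ZPeriodic {d : ℕ} {α : Type*} (f : Euc d → α) : Prop :=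
  ∀ (x : Euc d) (v : Fin d → ℤ), f (x + intVec v) = f x

/-- The fundamental domain `Q = [0,1)^d` of the torus. -/
def QCube (d : ℕ) : Set (Euc d) := {x | ∀ k, x k ∈ Ico (0:ℝ) 1}

/-- `σ = ∫₀¹ √(2W(a)) da`. -/
def sigma0 : ℝ := ∫ a in (0:ℝ)..1, Real.sqrt (2 * W a)

/-- A classical solution of the Allen–Cahn system (AC): `ℤ^d`-periodic in `x`, twice
continuously differentiable in `x` and once in `t` (with continuous derivatives), and
satisfying `ε ∂ₜ uᵢ = ε Δuᵢ - W'(uᵢ)/ε + λᵋ uᵢ` on `ℝ^d × (0,T)`, where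
`λᵋ = Σⱼ uⱼ (-ε Δuⱼ + W'(uⱼ)/ε)`. -/
structure IsACSolution (d N : ℕ) (T ε : ℝ) (u : Fin N → ℝ → Euc d → ℝ) : Prop where
  periodic : ∀ i t, ZPeriodic (u i t)
  regx : ∀ i t, ContDiff ℝ 2 (u i t)
  regt : ∀ i x, ContDiffOn ℝ 1 (fun s => u i s x) (Ico 0 T)
  cont_u : ∀ i, ContinuousOn (fun p : ℝ × Euc d => u i p.1 p.2) (Ico 0 T ×ˢ univ)
  cont_dt : ∀ i, ContinuousOn (fun p : ℝ × Euc d => deriv (fun s => u i s p.2) p.1)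
    (Ioo 0 T ×ˢ univ)
  cont_grad : ∀ i, ContinuousOn (fun p : ℝ × Euc d => gradient (u i p.1) p.2)
    (Ico 0 T ×ˢ univ)
  cont_lap : ∀ i, ContinuousOn (fun p : ℝ × Euc d => lap d (u i p.1) p.2)
    (Ico 0 T ×ˢ univ)
  eqn : ∀ i x, ∀ t ∈ Ioo 0 T,
    ε * deriv (fun s => u i s x) t =
      ε * lap d (u i t) x - W' (u i t x) / ε +
        (∑ j, u j t x * (-(ε * lap d (u j t) x) + W' (u j t x) / ε)) * u i t x

/-- The `(d-1)`-dimensional backward heat kernel centered at `(y,s)`. -/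
def rho (d : ℕ) (y : Euc d) (s : ℝ) (x : Euc d) (t : ℝ) : ℝ :=
  (4 * Real.pi * (s - t)) ^ (-(((d : ℝ) - 1) / 2)) * Real.exp (-‖x - y‖ ^ 2 / (4 * (s - t)))

/-- The energy density `eᵋ = σ⁻¹ Σᵢ (ε|∇uᵢ|²/2 + W(uᵢ)/ε)`. -/
def eDensity (d N : ℕ) (ε : ℝ) (u : Fin N → ℝ → Euc d → ℝ) (x : Euc d) (t : ℝ) : ℝ :=
  sigma0⁻¹ * ∑ i, (ε * ‖gradient (u i t) x‖ ^ 2 / 2 + W (u i t x) / ε)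

/-- The discrepancy density `ζᵋ = σ⁻¹ Σᵢ (ε|∇uᵢ|²/2 - W(uᵢ)/ε)`. -/
def xiDensity (d N : ℕ) (ε : ℝ) (u : Fin N → ℝ → Euc d → ℝ) (x : Euc d) (t : ℝ) : ℝ :=
  sigma0⁻¹ * ∑ i, (ε * ‖gradient (u i t) x‖ ^ 2 / 2 - W (u i t x) / ε)

open scoped Topology

lemma hasDerivAt_W (a : ℝ) : HasDerivAt W (W' a) a := by
  have h := (((hasDerivAt_id a).pow 2).mul (((hasDerivAt_id a).const_sub 1).pow 2)).div_const 2
  refine h.congr_deriv ?_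
  simp only [W', id, Pi.pow_apply]
  ring

lemma continuous_W : Continuous W := by unfold W; fun_prop

lemma continuous_W' : Continuous W' := by unfold W'; fun_prop

lemma sigma0_nonneg : 0 ≤ sigma0 :=
  intervalIntegral.integral_nonneg zero_le_one fun _ _ => Real.sqrt_nonneg _

section PartialDerivatives

variable {d : ℕ} {f g : Euc d → ℝ} {x : Euc d} (k : Fin d)

lemma gradient_apply : gradient f x k = pd d k f x := by
  have h : inner ℝ (gradient f x) (EuclideanSpace.single k 1) = pd d k f x := by
    unfold gradient pd
    exact InnerProductSpace.toDual_symm_apply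
  rw [← h, EuclideanSpace.inner_single_right]
  simp

lemma norm_gradient_sq : ‖gradient f x‖ ^ 2 = ∑ k, pd d k f x ^ 2 := by
  simp only [EuclideanSpace.real_norm_sq_eq, gradient_apply]

lemma pd_add (hf : DifferentiableAt ℝ f x) (hg : DifferentiableAt ℝ g x) :
    pd d k (fun z => f z + g z) x = pd d k f x + pd d k g x := by
  simp [pd, fderiv_fun_add hf hg]

lemma pd_sub (hf : DifferentiableAt ℝ f x) (hg : DifferentiableAt ℝ g x) :
    pd d k (fun z => f z - g z) x = pd d k f x - pd d k g x := by
  simp [pd, fderiv_fun_sub hf hg]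

lemma pd_mul (hf : DifferentiableAt ℝ f x) (hg : DifferentiableAt ℝ g x) :
    pd d k (fun z => f z * g z) x = f x * pd d k g x + pd d k f x * g x := by
  simp [pd, fderiv_fun_mul hf hg, mul_comm]

lemma pd_sum {ι : Type*} {s : Finset ι} {F : ι → Euc d → ℝ}
    (hF : ∀ i ∈ s, DifferentiableAt ℝ (F i) x) :
    pd d k (fun z => ∑ i ∈ s, F i z) x = ∑ i ∈ s, pd d k (F i) x := by
  simp [pd, fderiv_fun_sum hF]

lemma pd_comp {φ : ℝ → ℝ} {φ' : ℝ} (hφ : HasDerivAt φ φ' (f x)) (hf : DifferentiableAt ℝ f x) :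
    pd d k (fun z => φ (f z)) x = φ' * pd d k f x := by
  have h := (hφ.comp_hasFDerivAt x hf.hasFDerivAt).fderiv
  simp only [Function.comp_def] at h
  simp [pd, h]

lemma pd_coord_sub (y : Euc d) (j : Fin d) :
    pd d k (fun z => z j - y j) x = if j = k then 1 else 0 := by
  have h : HasFDerivAt (fun z : Euc d => z j - y j) (EuclideanSpace.proj j : Euc d →L[ℝ] ℝ) x :=
    (EuclideanSpace.proj j : Euc d →L[ℝ] ℝ).hasFDerivAt.sub_const _
  simp [pd, h.fderiv]

lemma contDiff_pd (hf : ContDiff ℝ 2 f) : ContDiff ℝ 1 (fun z => pd d k f z) := by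
  unfold pd
  exact (hf.fderiv_right (by norm_num)).clm_apply contDiff_const

lemma continuous_pd (hf : ContDiff ℝ 1 f) : Continuous (fun z => pd d k f z) := by
  unfold pd
  exact (hf.continuous_fderiv (by norm_num)).clm_apply continuous_const

lemma continuous_lap (hf : ContDiff ℝ 2 f) : Continuous (fun z => lap d f z) := by
  unfold lap
  exact continuous_finsetSum _ fun k _ => continuous_pd k (contDiff_pd k hf)

lemma pd_pd_eq (hf : ContDiff ℝ 2 f) (j : Fin d) :
    pd d j (fun z => pd d k f z) x =
      fderiv ℝ (fderiv ℝ f) x (EuclideanSpace.single j 1) (EuclideanSpace.single k 1) := by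
  have h : DifferentiableAt ℝ (fderiv ℝ f) x :=
    (hf.fderiv_right (m := 1) (by norm_num)).differentiable (by norm_num) x
  unfold pd
  simp [fderiv_clm_apply h (differentiableAt_const _)]

lemma pd_comm (hf : ContDiff ℝ 2 f) (j : Fin d) :
    pd d j (fun z => pd d k f z) x = pd d k (fun z => pd d j f z) x := by
  rw [pd_pd_eq k hf j, pd_pd_eq j hf k,
    (hf.contDiffAt.isSymmSndFDerivAt (by simp)) (EuclideanSpace.single j 1)]

lemma lap_add (hf : ContDiff ℝ 2 f) (hg : ContDiff ℝ 2 g) :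
    lap d (fun z => f z + g z) x = lap d f x + lap d g x := by
  have h1 : ∀ k, (fun z => pd d k (fun z => f z + g z) z) =
      fun z => pd d k f z + pd d k g z := fun k => funext fun z =>
    pd_add k (hf.differentiable (by norm_num) z) (hg.differentiable (by norm_num) z)
  unfold lap
  simp only [h1]
  rw [← Finset.sum_add_distrib]
  exact Finset.sum_congr rfl fun k _ => pd_add k
    ((contDiff_pd k hf).differentiable (by norm_num) x)
    ((contDiff_pd k hg).differentiable (by norm_num) x)

end PartialDerivatives

section Periodic

variable {d : ℕ} {f : Euc d → ℝ}

lemma ZPeriodic.pd (hf : ZPeriodic f) (k : Fin d) : ZPeriodic (fun x => pd d k f x) := by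
  intro x v
  have h : (fun z => f (z + intVec v)) = f := funext fun z => hf z v
  simp only [_root_.pd]
  rw [← fderiv_comp_add_right, h]

lemma ZPeriodic.lap (hf : ZPeriodic f) : ZPeriodic (fun x => lap d f x) := fun x v =>
  Finset.sum_congr rfl fun k _ => (hf.pd k).pd k x v

/-- A family of periodic functions, jointly continuous over a compact set of parameters, is
uniformly bounded. -/
lemma exists_bound_of_periodic {K : Set ℝ} (hK : IsCompact K) {F : ℝ → Euc d → ℝ}
    (hper : ∀ τ, ZPeriodic (F τ))
    (hcont : ContinuousOn (fun p : ℝ × Euc d => F p.1 p.2) (K ×ˢ univ)) :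
    ∃ C, ∀ τ ∈ K, ∀ x, |F τ x| ≤ C := by
  set Q : Set (Euc d) := (EuclideanSpace.equiv (Fin d) ℝ).symm '' Icc 0 1
  have hQ : IsCompact Q :=
    isCompact_Icc.image (EuclideanSpace.equiv (Fin d) ℝ).symm.continuous
  obtain ⟨C, hC⟩ := (hK.prod hQ).exists_bound_of_continuousOn
    (hcont.mono (prod_mono_right (subset_univ Q)))
  refine ⟨C, fun τ hτ x => ?_⟩
  rw [← hper τ x (fun k => -⌊x k⌋)]
  refine hC (τ, _) ⟨hτ, fun k => Int.fract (x k), ⟨fun k => Int.fract_nonneg _,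
    fun k => (Int.fract_lt_one _).le⟩, ?_⟩
  ext k
  simp [intVec, Int.fract, sub_eq_add_neg]

lemma ZPeriodic.exists_bound (hf : ZPeriodic f) (hc : Continuous f) : ∃ C, ∀ x, |f x| ≤ C := by
  obtain ⟨C, hC⟩ := exists_bound_of_periodic (isCompact_singleton (x := (0 : ℝ)))
    (F := fun _ => f) (fun _ => hf) (hc.comp continuous_snd).continuousOn
  exact ⟨C, hC 0 rfl⟩

end Periodic

/-- Continuous functions on `ℝ^d` of at most polynomial growth. -/
structure PolyGrowth {d : ℕ} (f : Euc d → ℝ) : Prop where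
  continuous : Continuous f
  bound : ∃ (C : ℝ) (n : ℕ), ∀ x, |f x| ≤ C * (1 + ‖x‖) ^ n

namespace PolyGrowth

variable {d : ℕ} {f g : Euc d → ℝ}

lemma of_bounded (hf : Continuous f) (h : ∃ C, ∀ x, |f x| ≤ C) : PolyGrowth f :=
  ⟨hf, h.choose, 0, by simpa using h.choose_spec⟩

lemma const (c : ℝ) : PolyGrowth (fun _ : Euc d => c) :=
  of_bounded continuous_const ⟨|c|, fun _ => le_rfl⟩

lemma add (hf : PolyGrowth f) (hg : PolyGrowth g) : PolyGrowth (fun x => f x + g x) := by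
  obtain ⟨C, n, hC⟩ := hf.bound
  obtain ⟨D, m, hD⟩ := hg.bound
  refine ⟨hf.continuous.add hg.continuous, |C| + |D|, n + m, fun x => ?_⟩
  have h1 : 1 ≤ 1 + ‖x‖ := by linarith [norm_nonneg x]
  have hn : (1 + ‖x‖) ^ n ≤ (1 + ‖x‖) ^ (n + m) := pow_le_pow_right₀ h1 (by omega)
  have hm : (1 + ‖x‖) ^ m ≤ (1 + ‖x‖) ^ (n + m) := pow_le_pow_right₀ h1 (by omega)
  calc |f x + g x| ≤ |f x| + |g x| := abs_add_le _ _
    _ ≤ |C| * (1 + ‖x‖) ^ n + |D| * (1 + ‖x‖) ^ m := by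
      gcongr
      · exact (hC x).trans (by gcongr; exact le_abs_self C)
      · exact (hD x).trans (by gcongr; exact le_abs_self D)
    _ ≤ |C| * (1 + ‖x‖) ^ (n + m) + |D| * (1 + ‖x‖) ^ (n + m) := by gcongr
    _ = _ := by ring

lemma mul (hf : PolyGrowth f) (hg : PolyGrowth g) : PolyGrowth (fun x => f x * g x) := by
  obtain ⟨C, n, hC⟩ := hf.bound
  obtain ⟨D, m, hD⟩ := hg.bound
  refine ⟨hf.continuous.mul hg.continuous, C * D, n + m, fun x => ?_⟩
  rw [abs_mul, pow_add]
  calc |f x| * |g x| ≤ (C * (1 + ‖x‖) ^ n) * (D * (1 + ‖x‖) ^ m) :=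
        mul_le_mul (hC x) (hD x) (abs_nonneg _) ((abs_nonneg _).trans (hC x))
    _ = _ := by ring

lemma const_mul (c : ℝ) (hf : PolyGrowth f) : PolyGrowth (fun x => c * f x) :=
  (const c).mul hf

lemma div_const (hf : PolyGrowth f) (c : ℝ) : PolyGrowth (fun x => f x / c) := by
  simpa only [div_eq_mul_inv] using hf.mul (const c⁻¹)

lemma neg (hf : PolyGrowth f) : PolyGrowth (fun x => -f x) := by
  simpa using hf.const_mul (-1)

lemma sub (hf : PolyGrowth f) (hg : PolyGrowth g) : PolyGrowth (fun x => f x - g x) := by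
  simpa only [sub_eq_add_neg] using hf.add hg.neg

lemma sq (hf : PolyGrowth f) : PolyGrowth (fun x => f x ^ 2) := by
  simpa only [_root_.sq] using hf.mul hf

lemma sum {ι : Type*} {s : Finset ι} {F : ι → Euc d → ℝ} (hF : ∀ i, PolyGrowth (F i)) :
    PolyGrowth (fun x => ∑ i ∈ s, F i x) := by
  classical
  induction s using Finset.induction_on with
  | empty => simpa using const 0
  | insert i s hi ih => simpa [Finset.sum_insert hi] using (hF i).add ih

lemma norm_sub (y : Euc d) : PolyGrowth (fun x => ‖x - y‖) := by
  refine ⟨by fun_prop, 1 + ‖y‖, 1, fun x => ?_⟩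
  rw [abs_norm]
  nlinarith [norm_sub_le x y, mul_nonneg (norm_nonneg x) (norm_nonneg y), norm_nonneg x]

lemma coord_sub (y : Euc d) (k : Fin d) : PolyGrowth (fun x => x k - y k) := by
  obtain ⟨C, n, hC⟩ := (norm_sub y).bound
  refine ⟨by fun_prop, C, n, fun x => le_trans ?_ ((le_abs_self _).trans (hC x))⟩
  simpa using PiLp.norm_apply_le (x - y) k

/-- Polynomial growth is absorbed by a Gaussian. -/
lemma integrable_mul_exp (hf : PolyGrowth f) {b : ℝ} (hb : 0 < b) (y : Euc d) :
    Integrable (fun x => f x * Real.exp (-b * ‖x - y‖ ^ 2)) := by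
  obtain ⟨C, n, hC⟩ := hf.bound
  have hgauss : Integrable (fun x : Euc d => Real.exp (-(b / 2) * ‖x - y‖ ^ 2)) := by
    have h := (GaussianFourier.integrable_cexp_neg_mul_sq_norm_add (V := Euc d)
      (b := ((b / 2 : ℝ) : ℂ)) (by simpa using hb) 0 0).norm
    have h2 : Integrable (fun x : Euc d => Real.exp (-(b / 2) * ‖x‖ ^ 2)) := by
      refine h.congr (Eventually.of_forall fun x => ?_)
      simp only [Complex.norm_exp]
      congr 1
      simp [← Complex.ofReal_pow]
    exact h2.comp_sub_right y
  have hcont := hf.continuous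
  refine (hgauss.const_mul (|C| * (n.factorial * Real.exp (1 + ‖y‖ + 1 / (2 * b))))).mono'
    (by fun_prop) (Eventually.of_forall fun x => ?_)
  have h1 : (1 + ‖x‖) ^ n ≤ n.factorial * Real.exp (1 + ‖x‖) := by
    have := Real.pow_div_factorial_le_exp (1 + ‖x‖) (by positivity) n
    rwa [div_le_iff₀' (by positivity)] at this
  have h2 : 1 + ‖x‖ + -b * ‖x - y‖ ^ 2 ≤
      (1 + ‖y‖ + 1 / (2 * b)) + -(b / 2) * ‖x - y‖ ^ 2 := by
    have h3 : ‖x‖ ≤ ‖x - y‖ + ‖y‖ := by simpa using norm_add_le (x - y) y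
    have h4 : ‖x - y‖ ≤ 1 / (2 * b) + b / 2 * ‖x - y‖ ^ 2 := by
      have h5 : 1 / (2 * b) + b / 2 * ‖x - y‖ ^ 2 - ‖x - y‖ =
          (b * ‖x - y‖ - 1) ^ 2 / (2 * b) := by field_simp; ring
      have h6 : 0 ≤ (b * ‖x - y‖ - 1) ^ 2 / (2 * b) := by positivity
      linarith
    linarith
  calc ‖f x * Real.exp (-b * ‖x - y‖ ^ 2)‖
      = |f x| * Real.exp (-b * ‖x - y‖ ^ 2) := by
        rw [norm_mul, Real.norm_eq_abs, Real.norm_eq_abs, abs_of_pos (Real.exp_pos _)]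
    _ ≤ (|C| * (n.factorial * Real.exp (1 + ‖x‖))) * Real.exp (-b * ‖x - y‖ ^ 2) := by
        gcongr
        exact (hC x).trans (mul_le_mul (le_abs_self C) h1 (by positivity) (abs_nonneg C))
    _ = |C| * (n.factorial * Real.exp (1 + ‖x‖ + -b * ‖x - y‖ ^ 2)) := by
        rw [Real.exp_add (1 + ‖x‖)]; ring
    _ ≤ |C| * (n.factorial *
          Real.exp ((1 + ‖y‖ + 1 / (2 * b)) + -(b / 2) * ‖x - y‖ ^ 2)) := by gcongr
    _ = _ := by rw [Real.exp_add]; ring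

end PolyGrowth

lemma ZPeriodic.polyGrowth {d : ℕ} {f : Euc d → ℝ} (hf : ZPeriodic f) (hc : Continuous f) :
    PolyGrowth f :=
  PolyGrowth.of_bounded hc (hf.exists_bound hc)

lemma ZPeriodic.comp_left {d : ℕ} {f : Euc d → ℝ} (hf : ZPeriodic f) (φ : ℝ → ℝ) :
    ZPeriodic (fun x => φ (f x)) := fun x v => congrArg φ (hf x v)

section HeatKernel

variable {d : ℕ} {y : Euc d} {s t : ℝ}

lemma norm_sub_sq_eq_sum (x y : Euc d) : ‖x - y‖ ^ 2 = ∑ k, (x k - y k) ^ 2 := by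
  simp [EuclideanSpace.real_norm_sq_eq]

lemma rho_nonneg (hst : t < s) (x : Euc d) : 0 ≤ rho d y s x t := by
  have h : 0 ≤ 4 * Real.pi * (s - t) :=
    mul_nonneg (by positivity) (sub_nonneg.2 hst.le)
  exact mul_nonneg (Real.rpow_nonneg h _) (Real.exp_pos _).le

lemma continuous_rho : Continuous (fun x => rho d y s x t) := by
  unfold rho
  fun_prop

lemma hasFDerivAt_rho (x : Euc d) :
    HasFDerivAt (fun x => rho d y s x t)
      (-(1 / (2 * (s - t)) * rho d y s x t) • innerSL ℝ (x - y)) x := by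
  have h := (((((hasFDerivAt_id x).sub_const y).norm_sq.const_mul (-(1 / (4 * (s - t))))).exp).const_mul
    ((4 * Real.pi * (s - t)) ^ (-(((d : ℝ) - 1) / 2))))
  have hrho : (fun x => rho d y s x t) = fun x => (4 * Real.pi * (s - t)) ^ (-(((d : ℝ) - 1) / 2)) *
      Real.exp (-(1 / (4 * (s - t))) * ‖id x - y‖ ^ 2) := by
    ext z
    simp only [rho, id]
    congr 2
    ring
  rw [hrho]
  refine h.congr_fderiv ?_
  ext v
  rw [congrFun hrho x]
  simp
  ring

lemma pd_rho (x : Euc d) (k : Fin d) :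
    pd d k (fun x => rho d y s x t) x = -(1 / (2 * (s - t)) * (x k - y k) * rho d y s x t) := by
  simp [pd, (hasFDerivAt_rho x).fderiv, EuclideanSpace.inner_single_right]
  ring

lemma PolyGrowth.integrable_rho_mul {f : Euc d → ℝ} (hf : PolyGrowth f) (hst : t < s) :
    Integrable (fun x => rho d y s x t * f x) := by
  refine ((hf.integrable_mul_exp (b := 1 / (4 * (s - t)))
    (by have := sub_pos.2 hst; positivity) y).const_mul
    ((4 * Real.pi * (s - t)) ^ (-(((d : ℝ) - 1) / 2)))).congr (Eventually.of_forall fun x => ?_)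
  simp only [rho]
  rw [show -(1 / (4 * (s - t))) * ‖x - y‖ ^ 2 = -‖x - y‖ ^ 2 / (4 * (s - t)) by ring]
  ring

/-- Integration by parts against the backward heat kernel. -/
lemma integral_rho_mul_divergence (hst : t < s) {Y : Fin d → Euc d → ℝ}
    (hY : ∀ k, PolyGrowth (Y k)) (hY1 : ∀ k, Differentiable ℝ (Y k))
    (hdY : ∀ k, PolyGrowth (fun x => pd d k (Y k) x)) :
    ∫ x, rho d y s x t *
      ∑ k, (pd d k (Y k) x - 1 / (2 * (s - t)) * ((x k - y k) * Y k x)) = 0 := by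
  have hX : ∀ k, PolyGrowth (fun x => 1 / (2 * (s - t)) * ((x k - y k) * Y k x)) := fun k =>
    ((PolyGrowth.coord_sub y k).mul (hY k)).const_mul _
  simp only [Finset.mul_sum]
  rw [integral_finsetSum _ fun k _ => ((hdY k).sub (hX k)).integrable_rho_mul hst]
  refine Finset.sum_eq_zero fun k _ => ?_
  have hrho : ∀ x, fderiv ℝ (fun x => rho d y s x t) x (EuclideanSpace.single k 1) * Y k x =
      -(rho d y s x t * (1 / (2 * (s - t)) * ((x k - y k) * Y k x))) := fun x => by
    have h := pd_rho (y := y) (s := s) (t := t) x k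
    simp only [pd] at h
    rw [h]
    ring
  have h := integral_mul_fderiv_eq_neg_fderiv_mul_of_integrable (μ := volume)
    (f := fun x => rho d y s x t) (g := Y k) (v := EuclideanSpace.single k 1)
    (by simp only [hrho]; exact ((hX k).integrable_rho_mul hst).neg)
    ((hdY k).integrable_rho_mul hst) ((hY k).integrable_rho_mul hst)
    (fun x _ => (hasFDerivAt_rho x).differentiableAt) (fun x _ => hY1 k x)
  simp only [hrho, integral_neg, neg_neg] at h
  simp_rw [mul_sub (rho d y s _ t)]
  exact (integral_sub ((hdY k).integrable_rho_mul hst) ((hX k).integrable_rho_mul hst)).trans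
    (sub_eq_zero.2 h)

end HeatKernel

section SpatialIdentities

variable {d : ℕ} {f g : Euc d → ℝ} {y : Euc d} {s t : ℝ}

/-- The radial derivative `(x - y) · ∇f`. -/
def radialDeriv (y : Euc d) (f : Euc d → ℝ) (x : Euc d) : ℝ :=
  ∑ k, (x k - y k) * pd d k f x

/-- The squared length of the gradient in coordinates. -/
def gradSq (f : Euc d → ℝ) (x : Euc d) : ℝ := ∑ k, pd d k f x ^ 2

/-- The energy density of a single component. -/
def energy (ε : ℝ) (f : Euc d → ℝ) (x : Euc d) : ℝ := ε * gradSq f x / 2 + W (f x) / ε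

lemma polyGrowth_pd (hf : ContDiff ℝ 2 f) (hper : ZPeriodic f) (k : Fin d) :
    PolyGrowth (fun x => pd d k f x) :=
  (hper.pd k).polyGrowth (contDiff_pd k hf).continuous

lemma polyGrowth_pd_pd (hf : ContDiff ℝ 2 f) (hper : ZPeriodic f) (j k : Fin d) :
    PolyGrowth (fun x => pd d j (fun z => pd d k f z) x) :=
  ((hper.pd k).pd j).polyGrowth (continuous_pd j (contDiff_pd k hf))

lemma polyGrowth_lap (hf : ContDiff ℝ 2 f) (hper : ZPeriodic f) :
    PolyGrowth (fun x => lap d f x) :=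
  hper.lap.polyGrowth (continuous_lap hf)

lemma polyGrowth_radialDeriv (hf : ContDiff ℝ 2 f) (hper : ZPeriodic f) :
    PolyGrowth (radialDeriv y f) :=
  PolyGrowth.sum fun k => (PolyGrowth.coord_sub y k).mul (polyGrowth_pd hf hper k)

lemma polyGrowth_gradSq (hf : ContDiff ℝ 2 f) (hper : ZPeriodic f) : PolyGrowth (gradSq f) :=
  PolyGrowth.sum fun k => (polyGrowth_pd hf hper k).sq

lemma polyGrowth_energy (hf : ContDiff ℝ 2 f) (hper : ZPeriodic f) (ε : ℝ) :
    PolyGrowth (energy ε f) :=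
  (((polyGrowth_gradSq hf hper).const_mul ε).div_const 2).add
    (((hper.comp_left W).polyGrowth (continuous_W.comp hf.continuous)).div_const ε)

/-- Green's formula with respect to the backward heat kernel. -/
lemma integral_rho_green (hst : t < s) (hf : ContDiff ℝ 2 f) (hfper : ZPeriodic f)
    (hg : ContDiff ℝ 2 g) (hgper : ZPeriodic g) :
    ∫ x, rho d y s x t * (∑ k, pd d k f x * pd d k g x + f x * lap d g x
      - 1 / (2 * (s - t)) * (f x * radialDeriv y g x)) = 0 := by
  have hfd : Differentiable ℝ f := hf.differentiable (by norm_num)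
  have hgd : ∀ k, Differentiable ℝ (fun x => pd d k g x) := fun k =>
    (contDiff_pd k hg).differentiable (by norm_num)
  have hpd : ∀ k x, pd d k (fun x => f x * pd d k g x) x =
      f x * pd d k (fun z => pd d k g z) x + pd d k f x * pd d k g x := fun k x =>
    pd_mul k (hfd x) (hgd k x)
  have hfP := hfper.polyGrowth hf.continuous
  rw [← integral_rho_mul_divergence (y := y) hst (Y := fun k x => f x * pd d k g x)
    (fun k => hfP.mul (polyGrowth_pd hg hgper k)) (fun k => hfd.mul (hgd k))
    (fun k => by
      simp only [hpd]
      exact (hfP.mul (polyGrowth_pd_pd hg hgper k k)).add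
        ((polyGrowth_pd hf hfper k).mul (polyGrowth_pd hg hgper k)))]
  congr 1
  ext x
  simp only [hpd, radialDeriv, lap, Finset.sum_sub_distrib, Finset.sum_add_distrib,
    Finset.mul_sum]
  congr 2
  · rw [add_comm]
  · exact Finset.sum_congr rfl fun k _ => by ring

/-- The Pohozaev identity, weighted by the backward heat kernel. -/
lemma integral_rho_pohozaev (hst : t < s) (hf : ContDiff ℝ 2 f) (hper : ZPeriodic f) (ε : ℝ) :
    ∫ x, rho d y s x t * (ε * (radialDeriv y f x * lap d f x + gradSq f x
        - 1 / (2 * (s - t)) * radialDeriv y f x ^ 2)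
      + (1 / (2 * (s - t)) * ‖x - y‖ ^ 2 - d) * energy ε f x
      - radialDeriv y f x * W' (f x) / ε) = 0 := by
  have hfd : Differentiable ℝ f := hf.differentiable (by norm_num)
  have hPd : ∀ k, Differentiable ℝ (fun x => pd d k f x) := fun k =>
    (contDiff_pd k hf).differentiable (by norm_num)
  have hXd : ∀ k, Differentiable ℝ (fun x : Euc d => x k - y k) := fun k => by fun_prop
  have hXPd : ∀ k, Differentiable ℝ (fun x => (x k - y k) * pd d k f x) := fun k =>
    (hXd k).mul (hPd k)
  have hrd : Differentiable ℝ (radialDeriv y f) := by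
    unfold radialDeriv
    exact Differentiable.fun_sum fun k _ => hXPd k
  have hWd : Differentiable ℝ (fun x => W (f x)) := fun x =>
    (hasDerivAt_W (f x)).differentiableAt.comp x (hfd x)
  have hgd : Differentiable ℝ (gradSq f) := by
    unfold gradSq
    exact Differentiable.fun_sum fun k _ => (hPd k).fun_pow 2
  have hed : Differentiable ℝ (energy ε f) := by
    unfold energy
    simp only [div_eq_mul_inv]
    exact ((hgd.const_mul ε).mul_const _).add (hWd.mul_const _)
  have hprd : ∀ k x, pd d k (radialDeriv y f) x =
      pd d k f x + ∑ j, (x j - y j) * pd d k (fun z => pd d j f z) x := fun k x => by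
    unfold radialDeriv
    rw [pd_sum k fun j _ => hXPd j x]
    simp only [pd_mul k (hXd _ x) (hPd _ x), pd_coord_sub, Finset.sum_add_distrib]
    simp [add_comm]
  have hpe : ∀ k x, pd d k (energy ε f) x =
      ε * ∑ j, pd d j f x * pd d k (fun z => pd d j f z) x + W' (f x) * pd d k f x / ε :=
    fun k x => by
    have h1 : energy ε f =
        fun x => (∑ j, ε / 2 * pd d j f x ^ 2) + W (f x) / ε := by
      ext x
      simp only [energy, gradSq, ← Finset.mul_sum]
      ring
    have hWe : DifferentiableAt ℝ (fun x => W (f x) / ε) x :=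
      ((hasDerivAt_W (f x)).div_const ε).differentiableAt.comp x (hfd x)
    have hPe : ∀ j, DifferentiableAt ℝ (fun x => ε / 2 * pd d j f x ^ 2) x := fun j =>
      ((hPd j x).fun_pow 2).const_mul (ε / 2)
    rw [h1, pd_add k (.fun_sum fun j _ => hPe j)
      hWe, pd_sum k fun j _ => hPe j,
      pd_comp k (φ := fun a => W a / ε) ((hasDerivAt_W (f x)).div_const ε) (hfd x),
      Finset.mul_sum]
    congr 1
    · refine Finset.sum_congr rfl fun j _ => ?_
      rw [pd_comp k (φ := fun a => ε / 2 * a ^ 2)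
        (((hasDerivAt_id' (pd d j f x)).fun_pow 2).const_mul (ε / 2)) (hPd j x)]
      push_cast
      ring
    · ring
  have hY : ∀ k x, pd d k (fun x => ε * (radialDeriv y f x * pd d k f x)
        - (x k - y k) * energy ε f x) x =
      ε * (radialDeriv y f x * pd d k (fun z => pd d k f z) x
        + (pd d k f x + ∑ j, (x j - y j) * pd d k (fun z => pd d j f z) x) * pd d k f x)
      - ((x k - y k) * (ε * ∑ j, pd d j f x * pd d k (fun z => pd d j f z) x
        + W' (f x) * pd d k f x / ε) + energy ε f x) := fun k x => by
    rw [pd_sub k (((hrd x).fun_mul (hPd k x)).const_mul ε) ((hXd k x).fun_mul (hed x)),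
      pd_mul k (differentiableAt_const _) ((hrd x).fun_mul (hPd k x)), pd_mul k (hrd x) (hPd k x),
      pd_mul k (hXd k x) (hed x), hprd, hpe, pd_coord_sub]
    simp [pd]
  have hP := polyGrowth_pd hf hper
  have hX := PolyGrowth.coord_sub y
  have hR := polyGrowth_radialDeriv (y := y) hf hper
  have hE := polyGrowth_energy hf hper ε
  have hH := polyGrowth_pd_pd hf hper
  have hW' : PolyGrowth (fun x => W' (f x)) :=
    (hper.comp_left W').polyGrowth (continuous_W'.comp hf.continuous)
  rw [← integral_rho_mul_divergence (y := y) hst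
    (Y := fun k x => ε * (radialDeriv y f x * pd d k f x) - (x k - y k) * energy ε f x)
    (fun k => ((hR.mul (hP k)).const_mul ε).sub ((hX k).mul hE))
    (fun k => ((hrd.mul (hPd k)).const_mul ε).sub ((hXd k).mul hed))
    (fun k => by
      simp only [hY]
      exact (((hR.mul (hH k k)).add (((hP k).add (.sum fun j => (hX j).mul (hH k j))).mul
        (hP k))).const_mul ε).sub (((hX k).mul (((PolyGrowth.sum fun j =>
          (hP j).mul (hH k j)).const_mul ε).add ((hW'.mul (hP k)).div_const ε))).add hE))]
  congr 1
  ext x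
  simp only [hY]
  congr 1
  have hsymm : ∑ k, (∑ j, (x j - y j) * pd d k (fun z => pd d j f z) x) * pd d k f x =
      ∑ k, (x k - y k) * ∑ j, pd d j f x * pd d k (fun z => pd d j f z) x := by
    simp only [Finset.mul_sum, Finset.sum_mul]
    rw [Finset.sum_comm]
    refine Finset.sum_congr rfl fun j _ => Finset.sum_congr rfl fun k _ => ?_
    rw [pd_comm j hf k]
    ring
  have hsum : ∀ k, ε * (radialDeriv y f x * pd d k (fun z => pd d k f z) x
        + (pd d k f x + ∑ j, (x j - y j) * pd d k (fun z => pd d j f z) x) * pd d k f x)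
      - ((x k - y k) * (ε * ∑ j, pd d j f x * pd d k (fun z => pd d j f z) x
        + W' (f x) * pd d k f x / ε) + energy ε f x)
      - 1 / (2 * (s - t)) * ((x k - y k) *
        (ε * (radialDeriv y f x * pd d k f x) - (x k - y k) * energy ε f x)) =
      (ε * radialDeriv y f x) * pd d k (fun z => pd d k f z) x + ε * pd d k f x ^ 2
      + ε * ((∑ j, (x j - y j) * pd d k (fun z => pd d j f z) x) * pd d k f x)
      - ε * ((x k - y k) * ∑ j, pd d j f x * pd d k (fun z => pd d j f z) x)
      - W' (f x) / ε * ((x k - y k) * pd d k f x) - energy ε f x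
      - (1 / (2 * (s - t)) * ε * radialDeriv y f x) * ((x k - y k) * pd d k f x)
      + (1 / (2 * (s - t)) * energy ε f x) * (x k - y k) ^ 2 := fun k => by ring
  simp only [hsum, Finset.sum_add_distrib, Finset.sum_sub_distrib, ← Finset.mul_sum]
  rw [hsymm, norm_sub_sq_eq_sum]
  have h1 : ∑ k, (x k - y k) * pd d k f x = radialDeriv y f x := rfl
  have h2 : ∑ k, pd d k f x ^ 2 = gradSq f x := rfl
  have h3 : ∑ k, pd d k (fun z => pd d k f z) x = lap d f x := rfl
  rw [h1, h2, h3, Finset.sum_const, Finset.card_univ, Fintype.card_fin, nsmul_eq_mul]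
  ring

end SpatialIdentities

section HeatKernelInTime

variable {d : ℕ} {y : Euc d} {s t t₁ t₂ : ℝ}

lemma hasDerivAt_rho (x : Euc d) (hst : t < s) :
    HasDerivAt (fun τ => rho d y s x τ)
      (rho d y s x t * (((d : ℝ) - 1) * (1 / (2 * (s - t)))
        - (1 / (2 * (s - t))) ^ 2 * ‖x - y‖ ^ 2)) t := by
  have hpos : 0 < s - t := sub_pos.2 hst
  have hs : HasDerivAt (fun τ => s - τ) (-1) t := by simpa using (hasDerivAt_id t).const_sub s
  have h1 := (hs.const_mul (4 * Real.pi)).rpow_const (p := -(((d : ℝ) - 1) / 2))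
    (Or.inl (by positivity))
  have h2 := ((hasDerivAt_const t (-‖x - y‖ ^ 2)).fun_div (hs.const_mul 4) (by positivity)).exp
  refine (h1.fun_mul h2).congr_deriv ?_
  rw [Real.rpow_sub_one (by positivity)]
  simp only [rho]
  field_simp
  ring

/-- Gaussian domination of the heat kernel, locally uniformly in time. -/
lemma exists_rho_le (h₂ : t₂ < s) :
    ∃ C, 0 ≤ C ∧ ∀ τ ∈ Icc t₁ t₂, ∀ x : Euc d,
      rho d y s x τ ≤ C * Real.exp (-(1 / (4 * (s - t₁))) * ‖x - y‖ ^ 2) := by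
  have hcont : ContinuousOn (fun τ => (4 * Real.pi * (s - τ)) ^ (-(((d : ℝ) - 1) / 2)))
      (Icc t₁ t₂) := by
    refine ContinuousOn.rpow_const (by fun_prop) fun τ hτ => Or.inl ?_
    have : 0 < s - τ := sub_pos.2 (hτ.2.trans_lt h₂)
    positivity
  obtain ⟨C, hC⟩ := isCompact_Icc.exists_bound_of_continuousOn hcont
  refine ⟨|C|, abs_nonneg C, fun τ hτ x => ?_⟩
  have hτs : 0 < s - τ := sub_pos.2 (hτ.2.trans_lt h₂)
  have h1s : s - τ ≤ s - t₁ := sub_le_sub_left hτ.1 s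
  unfold rho
  refine mul_le_mul ((le_abs_self _).trans ((hC τ hτ).trans (le_abs_self C))) ?_
    (Real.exp_pos _).le (abs_nonneg C)
  rw [Real.exp_le_exp, neg_div, neg_mul, neg_le_neg_iff, one_div_mul_eq_div]
  gcongr

lemma exists_abs_rho_sub_le (h₂ : t₂ < s) :
    ∃ C, 0 ≤ C ∧ ∀ τ ∈ Icc t₁ t₂, ∀ τ' ∈ Icc t₁ t₂, ∀ x : Euc d,
      |rho d y s x τ' - rho d y s x τ| ≤
        C * (1 + ‖x - y‖ ^ 2) * Real.exp (-(1 / (4 * (s - t₁))) * ‖x - y‖ ^ 2) * |τ' - τ| := by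
  obtain ⟨C, hC0, hC⟩ := exists_rho_le (d := d) (y := y) (t₁ := t₁) h₂
  set A := 1 / (2 * (s - t₂))
  refine ⟨C * (|(d : ℝ) - 1| * A + A ^ 2), ?_, fun τ hτ τ' hτ' x => ?_⟩
  · have : 0 < s - t₂ := sub_pos.2 h₂
    positivity
  refine (convex_Icc t₁ t₂).norm_image_sub_le_of_norm_hasDerivWithin_le
    (fun r hr => (hasDerivAt_rho x (hr.2.trans_lt h₂)).hasDerivWithinAt) (fun r hr => ?_) hτ hτ'
  have hrs : r < s := hr.2.trans_lt h₂
  have hr0 : 0 < s - r := sub_pos.2 hrs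
  have hs0 : 0 < s - t₂ := sub_pos.2 h₂
  have ha0 : 0 ≤ 1 / (2 * (s - r)) := by positivity
  have haA : 1 / (2 * (s - r)) ≤ A := by
    apply one_div_le_one_div_of_le (by positivity)
    linarith [hr.2]
  have hA0 : 0 ≤ A := ha0.trans haA
  rw [norm_mul, Real.norm_eq_abs, abs_of_nonneg (rho_nonneg hrs x), Real.norm_eq_abs]
  have h1 : |((d : ℝ) - 1) * (1 / (2 * (s - r))) - (1 / (2 * (s - r))) ^ 2 * ‖x - y‖ ^ 2| ≤
      (|(d : ℝ) - 1| * A + A ^ 2) * (1 + ‖x - y‖ ^ 2) := by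
    calc _ ≤ |((d : ℝ) - 1) * (1 / (2 * (s - r)))| + |(1 / (2 * (s - r))) ^ 2 * ‖x - y‖ ^ 2| :=
          abs_sub _ _
      _ = |(d : ℝ) - 1| * (1 / (2 * (s - r))) + (1 / (2 * (s - r))) ^ 2 * ‖x - y‖ ^ 2 := by
          rw [abs_mul, abs_of_nonneg ha0, abs_of_nonneg (by positivity :
            0 ≤ (1 / (2 * (s - r))) ^ 2 * ‖x - y‖ ^ 2)]
      _ ≤ |(d : ℝ) - 1| * A + A ^ 2 * ‖x - y‖ ^ 2 := by gcongr
      _ ≤ _ := by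
          have : 0 ≤ |(d : ℝ) - 1| * A * ‖x - y‖ ^ 2 := by positivity
          nlinarith [sq_nonneg A]
  calc _ ≤ C * Real.exp (-(1 / (4 * (s - t₁))) * ‖x - y‖ ^ 2) *
        ((|(d : ℝ) - 1| * A + A ^ 2) * (1 + ‖x - y‖ ^ 2)) :=
        mul_le_mul (hC r hr x) h1 (abs_nonneg _) (by positivity)
    _ = _ := by ring

end HeatKernelInTime

/-- Regularity of a single component, uniformly on a compact time interval. -/
structure TimeRegular {d : ℕ} (t₁ t₂ : ℝ) (v : ℝ → Euc d → ℝ) : Prop where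
  periodic : ∀ τ, ZPeriodic (v τ)
  contDiff : ∀ τ, ContDiff ℝ 2 (v τ)
  differentiableAt : ∀ τ ∈ Icc t₁ t₂, ∀ x, DifferentiableAt ℝ (fun r => v r x) τ
  continuousOn : ContinuousOn (fun p : ℝ × Euc d => v p.1 p.2) (Icc t₁ t₂ ×ˢ univ)
  continuousOn_deriv :
    ContinuousOn (fun p : ℝ × Euc d => deriv (fun r => v r p.2) p.1) (Icc t₁ t₂ ×ˢ univ)
  continuousOn_pd : ∀ k,
    ContinuousOn (fun p : ℝ × Euc d => pd d k (v p.1) p.2) (Icc t₁ t₂ ×ˢ univ)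
  continuousOn_lap :
    ContinuousOn (fun p : ℝ × Euc d => lap d (v p.1) p.2) (Icc t₁ t₂ ×ˢ univ)

namespace TimeRegular

variable {d : ℕ} {t₁ t₂ : ℝ} {v : ℝ → Euc d → ℝ}

lemma periodic_deriv (hv : TimeRegular t₁ t₂ v) (τ : ℝ) :
    ZPeriodic (fun x => deriv (fun r => v r x) τ) := fun x z => by
  simp only [hv.periodic _ x z]

lemma continuous_deriv (hv : TimeRegular t₁ t₂ v) {τ : ℝ} (hτ : τ ∈ Icc t₁ t₂) :
    Continuous (fun x => deriv (fun r => v r x) τ) :=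
  continuousOn_univ.1 <| hv.continuousOn_deriv.comp (f := fun x : Euc d => (τ, x))
    (by fun_prop) fun x _ => ⟨hτ, mem_univ x⟩

lemma polyGrowth_deriv (hv : TimeRegular t₁ t₂ v) {τ : ℝ} (hτ : τ ∈ Icc t₁ t₂) :
    PolyGrowth (fun x => deriv (fun r => v r x) τ) :=
  (hv.periodic_deriv τ).polyGrowth (hv.continuous_deriv hτ)

lemma continuousOn_energy (hv : TimeRegular t₁ t₂ v) (ε : ℝ) :
    ContinuousOn (fun p : ℝ × Euc d => energy ε (v p.1) p.2) (Icc t₁ t₂ ×ˢ univ) := by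
  unfold energy gradSq
  exact (((continuousOn_finsetSum _ fun k _ => (hv.continuousOn_pd k).pow 2).const_mul
    ε).div_const 2).add ((continuous_W.comp_continuousOn hv.continuousOn).div_const ε)

lemma periodic_energy (hv : TimeRegular t₁ t₂ v) (ε τ : ℝ) : ZPeriodic (energy ε (v τ)) :=
  fun x z => by
    have h1 : ∀ k, pd d k (v τ) (x + intVec z) = pd d k (v τ) x := fun k =>
      (hv.periodic τ).pd k x z
    simp only [energy, gradSq, h1, hv.periodic τ x z]

lemma exists_abs_sub_le (hv : TimeRegular t₁ t₂ v) :
    ∃ C, 0 ≤ C ∧ ∀ τ ∈ Icc t₁ t₂, ∀ τ' ∈ Icc t₁ t₂, ∀ x,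
      |v τ' x - v τ x| ≤ C * |τ' - τ| := by
  obtain ⟨C, hC⟩ := exists_bound_of_periodic isCompact_Icc hv.periodic_deriv hv.continuousOn_deriv
  refine ⟨|C|, abs_nonneg C, fun τ hτ τ' hτ' x => ?_⟩
  exact (convex_Icc t₁ t₂).norm_image_sub_le_of_norm_hasDerivWithin_le
    (fun r hr => (hv.differentiableAt r hr x).hasDerivAt.hasDerivWithinAt)
    (fun r hr => (hC r hr x).trans (le_abs_self C)) hτ hτ'

lemma hasDerivAt_W_comp (hv : TimeRegular t₁ t₂ v) {τ : ℝ} (hτ : τ ∈ Icc t₁ t₂) (x : Euc d) :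
    HasDerivAt (fun r => W (v r x)) (W' (v τ x) * deriv (fun r => v r x) τ) τ :=
  HasDerivAt.comp (h₂ := W) τ (hasDerivAt_W (v τ x)) (hv.differentiableAt τ hτ x).hasDerivAt

lemma exists_abs_W_sub_le (hv : TimeRegular t₁ t₂ v) :
    ∃ C, 0 ≤ C ∧ ∀ τ ∈ Icc t₁ t₂, ∀ τ' ∈ Icc t₁ t₂, ∀ x,
      |W (v τ' x) - W (v τ x)| ≤ C * |τ' - τ| := by
  obtain ⟨C, hC⟩ := exists_bound_of_periodic (K := Icc t₁ t₂) isCompact_Icc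
    (F := fun τ x => W' (v τ x) * deriv (fun r => v r x) τ)
    (fun τ x z => by
      simp only [hv.periodic _ x z])
    ((continuous_W'.comp_continuousOn hv.continuousOn).mul hv.continuousOn_deriv)
  refine ⟨|C|, abs_nonneg C, fun τ hτ τ' hτ' x => ?_⟩
  exact (convex_Icc t₁ t₂).norm_image_sub_le_of_norm_hasDerivWithin_le
    (fun r hr => (hv.hasDerivAt_W_comp hr x).hasDerivWithinAt)
    (fun r hr => (hC r hr x).trans (le_abs_self C)) hτ hτ'

lemma exists_abs_radialDeriv_le (hv : TimeRegular t₁ t₂ v) (y : Euc d) :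
    ∃ C, 0 ≤ C ∧ ∀ τ ∈ Icc t₁ t₂, ∀ x, |radialDeriv y (v τ) x| ≤ C * ‖x - y‖ := by
  choose C hC using fun k => exists_bound_of_periodic isCompact_Icc
    (fun τ => (hv.periodic τ).pd k) (hv.continuousOn_pd k)
  refine ⟨∑ k, |C k|, by positivity, fun τ hτ x => ?_⟩
  rw [Finset.sum_mul]
  refine (Finset.abs_sum_le_sum_abs _ _).trans (Finset.sum_le_sum fun k _ => ?_)
  rw [abs_mul, mul_comm]
  exact mul_le_mul ((hC k τ hτ x).trans (le_abs_self _))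
    (by simpa using PiLp.norm_apply_le (x - y) k) (abs_nonneg _) (abs_nonneg _)

/-- Restriction of a jointly continuous quantity to a fixed point in space. -/
lemma continuousAt_slice {F : ℝ → Euc d → ℝ} {t : ℝ}
    (hF : ContinuousOn (fun p : ℝ × Euc d => F p.1 p.2) (Icc t₁ t₂ ×ˢ univ))
    (ht : t ∈ Ioo t₁ t₂) (x : Euc d) : ContinuousAt (fun τ => F τ x) t :=
  (hF.comp (f := fun τ : ℝ => (τ, x)) (by fun_prop) fun _ hτ => ⟨hτ, mem_univ x⟩).continuousAt
    (Icc_mem_nhds ht.1 ht.2)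

end TimeRegular

lemma radialDeriv_add {d : ℕ} {f g : Euc d → ℝ} (hf : Differentiable ℝ f)
    (hg : Differentiable ℝ g) (y x : Euc d) :
    radialDeriv y (fun z => f z + g z) x = radialDeriv y f x + radialDeriv y g x := by
  simp only [radialDeriv, pd_add _ (hf x) (hg x), mul_add, Finset.sum_add_distrib]

/-- First variation of the weighted energy of a component. The mixed derivative `∂ₜ∇v` need not
exist: it is avoided by integrating the difference quotient by parts. -/
lemma TimeRegular.hasDerivAt_integral_rho_energy {d : ℕ} {t₁ t₂ s t : ℝ} {v : ℝ → Euc d → ℝ}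
    (hv : TimeRegular t₁ t₂ v) (ht : t ∈ Ioo t₁ t₂) (h₂ : t₂ < s) (y : Euc d) (ε : ℝ) :
    HasDerivAt (fun τ => ∫ x, rho d y s x τ * energy ε (v τ) x)
      (∫ x, rho d y s x t *
        ((((d : ℝ) - 1) * (1 / (2 * (s - t))) - (1 / (2 * (s - t))) ^ 2 * ‖x - y‖ ^ 2)
            * energy ε (v t) x
          + W' (v t x) * deriv (fun r => v r x) t / ε
          - ε * deriv (fun r => v r x) t *
            (lap d (v t) x - 1 / (2 * (s - t)) * radialDeriv y (v t) x))) t := by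
  have htI : t ∈ Icc t₁ t₂ := Ioo_subset_Icc_self ht
  have hst : t < s := ht.2.trans h₂
  have hdiff : ∀ τ, Differentiable ℝ (v τ) := fun τ => (hv.contDiff τ).differentiable (by norm_num)
  set a := 1 / (2 * (s - t)) with ha
  set Φ : ℝ → Euc d → ℝ := fun τ x =>
    (rho d y s x τ - rho d y s x t) / (τ - t) * energy ε (v τ) x
      + rho d y s x t * ((W (v τ x) - W (v t x)) / (τ - t) / ε
        - ε / 2 * ((v τ x - v t x) / (τ - t)) * ((lap d (v τ) x + lap d (v t) x)
          - a * (radialDeriv y (v τ) x + radialDeriv y (v t) x))) with hΦ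
  have hnear : ∀ᶠ τ in 𝓝[≠] t, τ ∈ Icc t₁ t₂ ∧ τ ≠ t :=
    Filter.Eventually.and (mem_nhdsWithin_of_mem_nhds (Icc_mem_nhds ht.1 ht.2))
      self_mem_nhdsWithin
  have hslope : ∀ τ ∈ Icc t₁ t₂, τ ≠ t →
      slope (fun τ => ∫ x, rho d y s x τ * energy ε (v τ) x) t τ = ∫ x, Φ τ x := by
    intro τ hτ hne
    have hE : ∀ r ∈ Icc t₁ t₂, Integrable (fun x => rho d y s x r * energy ε (v r) x) :=
      fun r hr => (polyGrowth_energy (hv.contDiff r) (hv.periodic r) ε).integrable_rho_mul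
        (hr.2.trans_lt h₂)
    have hsub := (hv.contDiff τ).sub (hv.contDiff t)
    have hadd := (hv.contDiff τ).add (hv.contDiff t)
    have hsubper : ZPeriodic (fun x => v τ x - v t x) := fun x z => by
      simp only [hv.periodic _ x z]
    have haddper : ZPeriodic (fun x => v τ x + v t x) := fun x z => by
      simp only [hv.periodic _ x z]
    have hgreen := integral_rho_green (y := y) hst hsub hsubper hadd haddper
    have hG := ((((PolyGrowth.sum (s := Finset.univ) fun k =>
      (polyGrowth_pd hsub hsubper k).mul (polyGrowth_pd hadd haddper k)).add
      ((hsubper.polyGrowth hsub.continuous).mul (polyGrowth_lap hadd haddper))).sub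
      (((hsubper.polyGrowth hsub.continuous).mul (polyGrowth_radialDeriv (y := y) hadd
        haddper)).const_mul a))).integrable_rho_mul (y := y) hst
    rw [slope_def_field, ← integral_sub (hE τ hτ) (hE t htI), ← integral_div,
      ← sub_zero (∫ x, _), ← mul_zero (ε / 2 / (τ - t)), ← hgreen, ← integral_const_mul]
    refine (integral_sub (((hE τ hτ).sub (hE t htI)).div_const _) (hG.const_mul _)).symm.trans
      (integral_congr_ae (Eventually.of_forall fun x => ?_))
    simp only [Pi.sub_apply]
    have hgrad : ∑ k, pd d k (fun x => v τ x - v t x) x * pd d k (fun x => v τ x + v t x) x =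
        gradSq (v τ) x - gradSq (v t) x := by
      rw [gradSq, gradSq, ← Finset.sum_sub_distrib]
      refine Finset.sum_congr rfl fun k _ => ?_
      rw [pd_sub k (hdiff τ x) (hdiff t x), pd_add k (hdiff τ x) (hdiff t x)]
      ring
    rw [hgrad, lap_add (hv.contDiff τ) (hv.contDiff t), radialDeriv_add (hdiff τ) (hdiff t)]
    simp only [hΦ, energy]
    ring
  rw [hasDerivAt_iff_tendsto_slope]
  refine Tendsto.congr' (f₁ := fun τ => ∫ x, Φ τ x)
    (hnear.mono fun τ hτ => (hslope τ hτ.1 hτ.2).symm) ?_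
  obtain ⟨C₁, hC₁0, hC₁⟩ := exists_rho_le (d := d) (y := y) (t₁ := t₁) h₂
  obtain ⟨C₂, hC₂0, hC₂⟩ := exists_abs_rho_sub_le (d := d) (y := y) (t₁ := t₁) h₂
  obtain ⟨C₃, hC₃⟩ := exists_bound_of_periodic isCompact_Icc (hv.periodic_energy ε)
    (hv.continuousOn_energy ε)
  obtain ⟨C₄, hC₄0, hC₄⟩ := hv.exists_abs_sub_le
  obtain ⟨C₅, hC₅0, hC₅⟩ := hv.exists_abs_W_sub_le
  obtain ⟨C₆, hC₆0, hC₆⟩ := hv.exists_abs_radialDeriv_le y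
  obtain ⟨C₇, hC₇⟩ := exists_bound_of_periodic isCompact_Icc (fun τ => (hv.periodic τ).lap)
    hv.continuousOn_lap
  set b := 1 / (4 * (s - t₁))
  have hb : 0 < b := by
    have : 0 < s - t₁ := sub_pos.2 (ht.1.trans hst)
    positivity
  have hquot : ∀ {τ p C : ℝ}, τ ≠ t → |p| ≤ C * |τ - t| → |p / (τ - t)| ≤ C := fun hne h => by
    rwa [abs_div, div_le_iff₀ (abs_pos.2 (sub_ne_zero.2 hne))]
  have hP : PolyGrowth (fun x : Euc d => C₂ * (1 + ‖x - y‖ ^ 2) * C₃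
      + C₁ * (C₅ / |ε| + |ε| / 2 * C₄ * ((C₇ + C₇) + |a| * (C₆ * ‖x - y‖ + C₆ * ‖x - y‖)))) := by
    have hr := PolyGrowth.norm_sub y
    have hc := PolyGrowth.const (d := d)
    exact ((((hc 1).add hr.sq).const_mul C₂).mul (hc C₃)).add (((hc _).add
      (((hc _).add (((hr.const_mul C₆).add (hr.const_mul C₆)).const_mul |a|)).const_mul
        _)).const_mul C₁)
  refine tendsto_integral_filter_of_dominated_convergence _ ?_ ?_
    (hP.integrable_mul_exp hb y) ?_
  · filter_upwards [hnear] with τ hτ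
    have hrad : ∀ r, Continuous (radialDeriv y (v r)) := fun r =>
      (polyGrowth_radialDeriv (hv.contDiff r) (hv.periodic r)).continuous
    have hlap : ∀ r, Continuous (fun x => lap d (v r) x) := fun r => continuous_lap (hv.contDiff r)
    have hen := (polyGrowth_energy (hv.contDiff τ) (hv.periodic τ) ε).continuous
    have hW : ∀ r, Continuous (fun x => W (v r x)) := fun r =>
      continuous_W.comp (hv.contDiff r).continuous
    have hvc : ∀ r, Continuous (v r) := fun r => (hv.contDiff r).continuous
    have hrho : ∀ r, Continuous (fun x => rho d y s x r) := fun r => continuous_rho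
    have hcont : Continuous (Φ τ) :=
      ((((hrho τ).sub (hrho t)).div_const _).mul hen).add ((hrho t).mul
        (((((hW τ).sub (hW t)).div_const _).div_const _).sub
        ((continuous_const.mul (((hvc τ).sub (hvc t)).div_const _)).mul
          (((hlap τ).add (hlap t)).sub (continuous_const.mul ((hrad τ).add (hrad t)))))))
    exact hcont.aestronglyMeasurable
  · filter_upwards [hnear] with τ hτ
    refine Eventually.of_forall fun x => ?_
    set G := Real.exp (-b * ‖x - y‖ ^ 2)
    have e1 := hquot hτ.2 (hC₂ t htI τ hτ.1 x)
    have e2 := hC₃ τ hτ.1 x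
    have e3 : |rho d y s x t| ≤ C₁ * G := by
      rw [abs_of_nonneg (rho_nonneg hst x)]
      exact hC₁ t htI x
    have e4 := hquot hτ.2 (hC₅ t htI τ hτ.1 x)
    have e5 := hquot hτ.2 (hC₄ t htI τ hτ.1 x)
    have e6 : |(lap d (v τ) x + lap d (v t) x)
        - a * (radialDeriv y (v τ) x + radialDeriv y (v t) x)| ≤
        (C₇ + C₇) + |a| * (C₆ * ‖x - y‖ + C₆ * ‖x - y‖) := by
      refine (abs_sub _ _).trans (add_le_add ((abs_add_le _ _).trans
        (add_le_add (hC₇ τ hτ.1 x) (hC₇ t htI x))) ?_)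
      rw [abs_mul]
      exact mul_le_mul_of_nonneg_left ((abs_add_le _ _).trans
        (add_le_add (hC₆ τ hτ.1 x) (hC₆ t htI x))) (abs_nonneg a)
    have e7 : |(W (v τ x) - W (v t x)) / (τ - t) / ε
        - ε / 2 * ((v τ x - v t x) / (τ - t)) * ((lap d (v τ) x + lap d (v t) x)
          - a * (radialDeriv y (v τ) x + radialDeriv y (v t) x))| ≤
        C₅ / |ε| + |ε| / 2 * C₄ * ((C₇ + C₇) + |a| * (C₆ * ‖x - y‖ + C₆ * ‖x - y‖)) := by
      refine (abs_sub _ _).trans (add_le_add ?_ ?_)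
      · rw [abs_div _ ε]
        gcongr
      · rw [abs_mul, abs_mul, abs_div ε, abs_two]
        gcongr
    calc ‖Φ τ x‖ ≤ _ := norm_add_le _ _
      _ ≤ C₂ * (1 + ‖x - y‖ ^ 2) * G * C₃ + C₁ * G * (C₅ / |ε|
          + |ε| / 2 * C₄ * ((C₇ + C₇) + |a| * (C₆ * ‖x - y‖ + C₆ * ‖x - y‖))) := by
        rw [Real.norm_eq_abs, Real.norm_eq_abs, abs_mul, abs_mul]
        exact add_le_add (mul_le_mul e1 e2 (abs_nonneg _) (by positivity))
          (mul_le_mul e3 e7 (abs_nonneg _) (by positivity))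
      _ = _ := by ring
  · refine Eventually.of_forall fun x => ?_
    have hlim : ∀ {F : ℝ → ℝ} {F' : ℝ}, HasDerivAt F F' t →
        Tendsto (fun τ => (F τ - F t) / (τ - t)) (𝓝[≠] t) (𝓝 F') := fun {F F'} h => by
      have := hasDerivAt_iff_tendsto_slope.1 h
      rwa [slope_fun_def_field] at this
    have hcont : ∀ {F : ℝ → ℝ}, ContinuousAt F t → Tendsto F (𝓝[≠] t) (𝓝 (F t)) := fun h =>
      h.tendsto.mono_left nhdsWithin_le_nhds
    have l1 := hlim (hasDerivAt_rho (y := y) x hst)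
    have l2 := hcont (TimeRegular.continuousAt_slice (F := fun τ => energy ε (v τ))
      (hv.continuousOn_energy ε) ht x)
    have l3 := hlim (hv.hasDerivAt_W_comp htI x)
    have l4 := hlim (hv.differentiableAt t htI x).hasDerivAt
    have l5 := hcont (TimeRegular.continuousAt_slice (F := fun τ => lap d (v τ))
      hv.continuousOn_lap ht x)
    have l6 : Tendsto (fun τ => radialDeriv y (v τ) x) (𝓝[≠] t) (𝓝 (radialDeriv y (v t) x)) :=
      tendsto_finsetSum _ fun k _ => (hcont (TimeRegular.continuousAt_slice
        (F := fun τ => pd d k (v τ)) (hv.continuousOn_pd k) ht x)).const_mul _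
    have l7 := (l1.mul l2).add (((l3.div_const ε).sub ((l4.const_mul (ε / 2)).mul
      ((l5.add_const (lap d (v t) x)).sub ((l6.add_const (radialDeriv y (v t) x)).const_mul
        a)))).const_mul (rho d y s x t))
    convert l7 using 2
    ring

section ACSystem

variable {d N : ℕ} {T ε : ℝ} {u : Fin N → ℝ → Euc d → ℝ}

lemma IsACSolution.timeRegular (hu : IsACSolution d N T ε u) {t₁ t₂ : ℝ} (h₁ : 0 < t₁)
    (h₂ : t₂ < T) (i : Fin N) : TimeRegular t₁ t₂ (u i) := by
  have hIoo : Icc t₁ t₂ ⊆ Ioo 0 T := fun τ hτ => ⟨h₁.trans_le hτ.1, hτ.2.trans_lt h₂⟩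
  have hIco : Icc t₁ t₂ ×ˢ (univ : Set (Euc d)) ⊆ Ico 0 T ×ˢ univ :=
    prod_mono (hIoo.trans Ioo_subset_Ico_self) subset_rfl
  refine ⟨hu.periodic i, hu.regx i, fun τ hτ x => ?_, (hu.cont_u i).mono hIco,
    (hu.cont_dt i).mono (prod_mono hIoo subset_rfl), fun k => ?_, (hu.cont_lap i).mono hIco⟩
  · exact ((hu.regt i x).differentiableOn (by norm_num)).differentiableAt
      (Ico_mem_nhds (hIoo hτ).1 (hIoo hτ).2)
  · simp only [← gradient_apply k]
    exact (EuclideanSpace.proj k : Euc d →L[ℝ] ℝ).continuous.comp_continuousOn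
      ((hu.cont_grad i).mono hIco)

lemma sum_mul_deriv_eq_zero {t₁ t₂ t c : ℝ} (hv : ∀ i, TimeRegular t₁ t₂ (u i))
    (ht : t ∈ Ioo t₁ t₂) (x : Euc d) (hc : ∀ τ ∈ Icc t₁ t₂, ∑ i, u i τ x ^ 2 = c) :
    ∑ i, u i t x * deriv (fun r => u i r x) t = 0 := by
  have h1 : HasDerivAt (fun τ => ∑ i, u i τ x ^ 2)
      (∑ i, 2 * u i t x ^ 1 * deriv (fun r => u i r x) t) t :=
    HasDerivAt.fun_sum fun i _ => by
      simpa using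
        ((hv i).differentiableAt t (Ioo_subset_Icc_self ht) x).hasDerivAt.fun_pow 2
  have h2 : HasDerivAt (fun τ => ∑ i, u i τ x ^ 2) 0 t :=
    (hasDerivAt_const t c).congr_of_eventuallyEq <| by
      filter_upwards [Icc_mem_nhds ht.1 ht.2] with τ hτ using hc τ hτ
  have h3 := h1.unique h2
  simp only [pow_one, mul_assoc, ← Finset.mul_sum] at h3
  linarith

lemma sum_mul_radialDeriv_eq_zero {f : Fin N → Euc d → ℝ} {c : ℝ}
    (hf : ∀ i, Differentiable ℝ (f i)) (hc : ∀ x, ∑ i, f i x ^ 2 = c) (x y : Euc d) :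
    ∑ i, f i x * radialDeriv y (f i) x = 0 := by
  have h : ∀ k, ∑ i, f i x * pd d k (f i) x = 0 := fun k => by
    have h1 : pd d k (fun z => ∑ i, f i z * f i z) x = 0 := by
      simp [← pow_two, hc, pd]
    rw [pd_sum k fun i _ => (hf i x).fun_mul (hf i x)] at h1
    simp only [pd_mul k (hf _ x) (hf _ x), mul_comm (pd d k _ x), ← two_mul,
      ← Finset.mul_sum] at h1
    linarith
  simp only [radialDeriv, Finset.mul_sum]
  rw [Finset.sum_comm]
  refine Finset.sum_eq_zero fun k _ => ?_
  simp only [mul_left_comm (f _ x), ← Finset.mul_sum, h, mul_zero]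

lemma eDensity_eq (x : Euc d) (t : ℝ) :
    eDensity d N ε u x t = sigma0⁻¹ * ∑ i, energy ε (u i t) x := by
  simp only [eDensity, norm_gradient_sq, energy, gradSq]

lemma xiDensity_eq (x : Euc d) (t : ℝ) :
    xiDensity d N ε u x t = sigma0⁻¹ * ∑ i, (ε * gradSq (u i t) x / 2 - W (u i t x) / ε) := by
  simp only [xiDensity, norm_gradient_sq, gradSq]

lemma integral_rho_mul_sum {y : Euc d} {s t : ℝ} (hst : t < s) (c : ℝ) {F : Fin N → Euc d → ℝ}
    (hF : ∀ i, PolyGrowth (F i)) :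
    ∫ x, rho d y s x t * (c * ∑ i, F i x) = c * ∑ i, ∫ x, rho d y s x t * F i x := by
  rw [← integral_finsetSum _ fun i _ => (hF i).integrable_rho_mul hst, ← integral_const_mul]
  congr 1
  ext x
  rw [mul_left_comm, Finset.mul_sum]

/-- Pointwise form of the monotonicity formula: after adding the Pohozaev identity, the terms
combine into the discrepancy and the nonpositive square `-ε (v - a p) ^ 2`. The multiplier `l`
drops out, as both `v` and `p` are orthogonal to `U`. -/
lemma sum_firstVariation_le {ι : Type*} [Fintype ι] {ε a l n r : ℝ} (hε : 0 ≤ ε)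
    {U v p L g w w' : ι → ℝ}
    (heq : ∀ i, ε * v i = ε * L i - w' i / ε + l * U i)
    (hv : ∑ i, U i * v i = 0) (hp : ∑ i, U i * p i = 0) :
    ∑ i, ((((n - 1) * a - a ^ 2 * r) * (ε * g i / 2 + w i / ε) + w' i * v i / ε
        - ε * v i * (L i - a * p i))
      + a * (ε * (p i * L i + g i - a * p i ^ 2) + (a * r - n) * (ε * g i / 2 + w i / ε)
        - p i * w' i / ε)) ≤ a * ∑ i, (ε * g i / 2 - w i / ε) := by
  have h : ∀ i, (((n - 1) * a - a ^ 2 * r) * (ε * g i / 2 + w i / ε) + w' i * v i / ε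
        - ε * v i * (L i - a * p i))
      + a * (ε * (p i * L i + g i - a * p i ^ 2) + (a * r - n) * (ε * g i / 2 + w i / ε)
        - p i * w' i / ε) ≤
      a * (ε * g i / 2 - w i / ε) + (l * (U i * v i) - a * l * (U i * p i)) := fun i => by
    have h1 := mul_nonneg hε (sq_nonneg (v i - a * p i))
    linear_combination h1 + (v i - a * p i) * heq i
  refine (Finset.sum_le_sum fun i _ => h i).trans_eq ?_
  rw [Finset.sum_add_distrib, Finset.sum_sub_distrib, ← Finset.mul_sum, ← Finset.mul_sum,
    ← Finset.mul_sum, hv, hp]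
  ring

end ACSystem

/-- (Huisken-type monotonicity for (AC).) For a classical solution of
(AC) with `Σᵢ uᵢ² ≡ 1`, and the backward heat kernel `ρ = ρ_{y,s}`, for every
`t ∈ (0, min T s)`:
`(d/dt) ∫_{ℝ^d} ρ eᵋ dx ≤ (1/(2(s-t))) ∫_{ℝ^d} ρ ζᵋ dx`. -/
theorem huisken_monotonicity_epsilon
    {d N : ℕ} (hd : 2 ≤ d) (hN : 2 ≤ N) {T ε : ℝ} (hT : 0 < T) (hε : ε ∈ Ioo (0:ℝ) 1)
    (u : Fin N → ℝ → Euc d → ℝ) (hu : IsACSolution d N T ε u)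
    (hsph : ∀ x, ∀ t ∈ Ico 0 T, ∑ i, (u i t x) ^ 2 = 1)
    (y : Euc d) {s : ℝ} (hs : 0 < s) :
    ∀ t ∈ Ioo 0 (min T s),
      ∃ I : ℝ,
        HasDerivAt (fun τ => ∫ x : Euc d, rho d y s x τ * eDensity d N ε u x τ) I t ∧
        I ≤ (1 / (2 * (s - t))) * ∫ x : Euc d, rho d y s x t * xiDensity d N ε u x t := by
  rintro t ⟨ht0, htm⟩
  obtain ⟨t₂, htt₂, ht₂⟩ := exists_between htm
  have h₂T : t₂ < T := ht₂.trans_le (min_le_left _ _)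
  have h₂s : t₂ < s := ht₂.trans_le (min_le_right _ _)
  have hst : t < s := htt₂.trans h₂s
  have ht : t ∈ Ioo (t / 2) t₂ := ⟨half_lt_self ht0, htt₂⟩
  have hε0 : 0 < ε := hε.1
  have hv : ∀ i, TimeRegular (t / 2) t₂ (u i) := fun i => hu.timeRegular (half_pos ht0) h₂T i
  have hnorm : ∀ τ ∈ Icc (t / 2) t₂, ∀ x, ∑ i, u i τ x ^ 2 = 1 := fun τ hτ x =>
    hsph x τ ⟨(half_pos ht0).le.trans hτ.1, hτ.2.trans_lt h₂T⟩
  have hen : ∀ τ i, PolyGrowth (energy ε (u i τ)) := fun τ i =>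
    polyGrowth_energy (hu.regx i τ) (hu.periodic i τ) ε
  refine ⟨_, ((HasDerivAt.fun_sum (u := Finset.univ) fun i _ =>
    (hv i).hasDerivAt_integral_rho_energy ht h₂s y ε).const_mul
      sigma0⁻¹).congr_of_eventuallyEq ?_, ?_⟩
  · filter_upwards [Icc_mem_nhds ht.1 ht.2] with τ hτ
    simp only [eDensity_eq]
    exact integral_rho_mul_sum (hτ.2.trans_lt h₂s) _ (hen τ)
  simp only [xiDensity_eq]
  have hpoh : ∀ i, _ := fun i =>
    integral_rho_pohozaev (y := y) hst (hu.regx i t) (hu.periodic i t) ε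
  set a := 1 / (2 * (s - t))
  have hr := (PolyGrowth.norm_sub y).sq
  have hp : ∀ i, PolyGrowth (radialDeriv y (u i t)) := fun i =>
    polyGrowth_radialDeriv (hu.regx i t) (hu.periodic i t)
  have hL : ∀ i, PolyGrowth (fun x => lap d (u i t) x) := fun i =>
    polyGrowth_lap (hu.regx i t) (hu.periodic i t)
  have hg : ∀ i, PolyGrowth (gradSq (u i t)) := fun i =>
    polyGrowth_gradSq (hu.regx i t) (hu.periodic i t)
  have hV : ∀ i, PolyGrowth (fun x => deriv (fun r => u i r x) t) := fun i =>
    (hv i).polyGrowth_deriv (Ioo_subset_Icc_self ht)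
  have hW : ∀ i, PolyGrowth (fun x => W (u i t x)) := fun i =>
    ((hu.periodic i t).comp_left W).polyGrowth (continuous_W.comp (hu.regx i t).continuous)
  have hW' : ∀ i, PolyGrowth (fun x => W' (u i t x)) := fun i =>
    ((hu.periodic i t).comp_left W').polyGrowth (continuous_W'.comp (hu.regx i t).continuous)
  have hc := PolyGrowth.const (d := d)
  have hD := fun i => (((((hc (((d : ℝ) - 1) * a)).sub (hr.const_mul (a ^ 2))).mul (hen t i)).add
    (((hW' i).mul (hV i)).div_const ε)).sub
      (((hV i).const_mul ε).mul ((hL i).sub ((hp i).const_mul a))))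
  have hP := fun i => ((((((hp i).mul (hL i)).add (hg i)).sub
    ((hp i).sq.const_mul a)).const_mul ε).add
      (((hr.const_mul a).sub (hc d)).mul (hen t i))).sub (((hp i).mul (hW' i)).div_const ε)
  have hX := fun i => (((hg i).const_mul ε).div_const 2).sub ((hW i).div_const ε)
  rw [integral_rho_mul_sum hst _ hX, mul_left_comm]
  refine mul_le_mul_of_nonneg_left ?_ (inv_nonneg.2 sigma0_nonneg)
  rw [← integral_rho_mul_sum hst a hX]
  calc _ = ∑ i, ∫ x, rho d y s x t * (_ + a * _) := Finset.sum_congr rfl fun i _ => by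
        rw [← add_zero (∫ x, _), ← mul_zero a, ← hpoh i, ← integral_const_mul,
          ← integral_add ((hD i).integrable_rho_mul hst)
            (((hP i).integrable_rho_mul hst).const_mul a)]
        simp only [mul_left_comm a, ← mul_add]
        rfl
    _ = ∫ x, rho d y s x t * (1 * ∑ i, (_ + a * _)) := by
        rw [integral_rho_mul_sum hst 1 fun i => (hD i).add ((hP i).const_mul a), one_mul]
    _ ≤ _ := by
        refine integral_mono
          (((PolyGrowth.sum fun i => (hD i).add
            ((hP i).const_mul a)).const_mul 1).integrable_rho_mul hst)
          (((PolyGrowth.sum hX).const_mul a).integrable_rho_mul hst) fun x =>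
          mul_le_mul_of_nonneg_left ?_ (rho_nonneg hst x)
        rw [one_mul]
        exact sum_firstVariation_le hε0.le
          (fun i => hu.eqn i x t ⟨ht0, htm.trans_le (min_le_left _ _)⟩)
          (sum_mul_deriv_eq_zero hv ht x fun τ hτ => hnorm τ hτ x)
          (sum_mul_radialDeriv_eq_zero (fun i => (hu.regx i t).differentiable (by norm_num))
            (hnorm t (Ioo_subset_Icc_self ht)) x y)
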